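/- In the Heisenberg algebra H₂ with [p,q] = iε and normal monomials N(a,b) = p^a q^b, the Wick-ordered monomials satisfy the inverse relation N(a,b) = Σ_{r=0}^{min(a,b)} ((iε/2)^r / r!) · (a!/(a-r)!) · (b!/(b-r)!) · S(a-r, b-r). -/

import Mathlib

open Finset

/-- The symmetrized (Wick-ordered) product of `a` copies of `p` and `b` copies of `q`:
the average over all `(a+b)!` orderings. -/
noncomputable def wickMonomial {A : Type*} [Ring A] [Algebra ℂ A]
    (p q : A) (a b : ℕ) : A :=
  (((a + b).factorial : ℂ))⁻¹ •
    ∑ σ : Equiv.Perm (Fin (a + b)),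
      (List.ofFn (fun i : Fin (a + b) => if ((σ i : Fin (a + b)) : ℕ) < a then p else q)).prod

/-- The sum over all orderings of the product of the family `f`. -/
def permProdSum {A : Type*} [Ring A] {n : ℕ} (f : Fin n → A) : A :=
  ∑ σ : Equiv.Perm (Fin n), (List.ofFn (fun i => f (σ i))).prod

theorem permProdSum_comp_perm {A : Type*} [Ring A] {n : ℕ} (f : Fin n → A)
    (τ : Equiv.Perm (Fin n)) : permProdSum (fun i => f (τ i)) = permProdSum f :=
  Equiv.sum_comp (Equiv.mulLeft τ)
    (fun σ : Equiv.Perm (Fin n) => (List.ofFn (fun i => f (σ i))).prod)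

theorem permProdSum_swap_succ {A : Type*} [Ring A] {n : ℕ} (f : Fin (n + 1) → A)
    (k : Fin (n + 1)) :
    permProdSum (fun j : Fin n => f (Equiv.swap 0 k j.succ)) =
      permProdSum (fun j => f (k.succAbove j)) := by
  rcases Fin.eq_zero_or_eq_succ k with rfl | ⟨i, rfl⟩
  · simp
  · rw [← permProdSum_comp_perm (fun j => f (i.succ.succAbove j)) i.cycleRange]
    simp only [Fin.succAbove_cycleRange]

theorem permProdSum_succ {A : Type*} [Ring A] {n : ℕ} (f : Fin (n + 1) → A) :
    permProdSum f = ∑ k, f k * permProdSum (fun j => f (k.succAbove j)) := by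
  rw [permProdSum, ← Equiv.sum_comp Equiv.Perm.decomposeFin.symm, Fintype.sum_prod_type]
  refine Finset.sum_congr rfl fun k _ => ?_
  rw [← permProdSum_swap_succ, permProdSum, Finset.mul_sum]
  refine Finset.sum_congr rfl fun e _ => ?_
  simp [List.ofFn_succ]

theorem permProdSum_threshold_succ {A : Type*} [Ring A] (p q : A) {n a : ℕ} (ha : a ≤ n + 1) :
    permProdSum (fun i : Fin (n + 1) => if (i : ℕ) < a then p else q) =
      a • (p * permProdSum (fun i : Fin n => if (i : ℕ) < a - 1 then p else q)) +
      (n + 1 - a) • (q * permProdSum (fun i : Fin n => if (i : ℕ) < a then p else q)) := by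
  have key (k : Fin (n + 1)) :
      ((if (k : ℕ) < a then p else q) *
        permProdSum (fun j : Fin n => if (k.succAbove j : ℕ) < a then p else q)) =
      if (k : ℕ) < a then
        p * permProdSum (fun i : Fin n => if (i : ℕ) < a - 1 then p else q)
      else q * permProdSum (fun i : Fin n => if (i : ℕ) < a then p else q) := by
    split_ifs with h
    all_goals
      congr 2
      funext j
      congr 1
      simp only [Fin.succAbove, Fin.lt_def, Fin.val_castSucc]
      split_ifs <;> simp <;> omega
  rw [permProdSum_succ, Finset.sum_congr rfl fun k _ => key k, Finset.sum_ite,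
    Finset.sum_const, Finset.sum_const]
  have hlt : (Finset.univ.filter fun k : Fin (n + 1) => (k : ℕ) < a).card = a := by
    rw [Fin.card_filter_val_lt, min_eq_right ha]
  have hge : (Finset.univ.filter fun k : Fin (n + 1) => ¬ (k : ℕ) < a).card = n + 1 - a := by
    have := Finset.card_filter_add_card_filter_not (s := Finset.univ)
      (fun k : Fin (n + 1) => (k : ℕ) < a)
    rw [hlt, Finset.card_univ, Fintype.card_fin] at this
    omega
  rw [hlt, hge]

theorem wickMonomial_eq_permProdSum {A : Type*} [Ring A] [Algebra ℂ A] (p q : A) {a b n : ℕ}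
    (h : a + b = n) :
    wickMonomial p q a b = ((n.factorial : ℂ))⁻¹ •
      permProdSum (fun i : Fin n => if (i : ℕ) < a then p else q) := by
  subst h
  rfl

theorem add_smul_wickMonomial {A : Type*} [Ring A] [Algebra ℂ A] (p q : A) (a b : ℕ) :
    ((a : ℂ) + b) • wickMonomial p q a b =
      (a : ℂ) • (p * wickMonomial p q (a - 1) b) + (b : ℂ) • (q * wickMonomial p q a (b - 1)) := by
  obtain h | ⟨n, h⟩ : a + b = 0 ∨ ∃ n, a + b = n + 1 := by
    rcases Nat.eq_zero_or_eq_succ_pred (a + b) with h | h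
    exacts [Or.inl h, Or.inr ⟨_, h⟩]
  · obtain ⟨rfl, rfl⟩ : a = 0 ∧ b = 0 := by omega
    simp
  have hp : (a : ℂ) • (p * wickMonomial p q (a - 1) b) = (a : ℂ) • (((n.factorial : ℂ))⁻¹ •
      (p * permProdSum (fun i : Fin n => if (i : ℕ) < a - 1 then p else q))) := by
    rcases Nat.eq_zero_or_pos a with rfl | ha
    · simp
    · rw [wickMonomial_eq_permProdSum p q (show a - 1 + b = n by omega), mul_smul_comm]
  have hq : (b : ℂ) • (q * wickMonomial p q a (b - 1)) = (b : ℂ) • (((n.factorial : ℂ))⁻¹ •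
      (q * permProdSum (fun i : Fin n => if (i : ℕ) < a then p else q))) := by
    rcases Nat.eq_zero_or_pos b with rfl | hb
    · simp
    · rw [wickMonomial_eq_permProdSum p q (show a + (b - 1) = n by omega), mul_smul_comm]
  have hn : (a : ℂ) + b = (n : ℂ) + 1 := by exact_mod_cast h
  have hn0 : (n : ℂ) + 1 ≠ 0 := by exact_mod_cast n.succ_ne_zero
  rw [hp, hq, wickMonomial_eq_permProdSum p q h, permProdSum_threshold_succ p q (by omega),
    show n + 1 - a = b by omega, hn, Nat.factorial_succ, smul_smul]
  push_cast
  rw [mul_inv, mul_inv_cancel_left₀ hn0, smul_add, ← Nat.cast_smul_eq_nsmul ℂ a,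
    ← Nat.cast_smul_eq_nsmul ℂ b, smul_comm (a : ℂ), smul_comm (b : ℂ)]

theorem wickMonomial_zero_left {A : Type*} [Ring A] [Algebra ℂ A] (p q : A) (b : ℕ) :
    wickMonomial p q 0 b = q ^ b := by
  have hb : ((b.factorial : ℕ) : ℂ) ≠ 0 := by exact_mod_cast b.factorial_ne_zero
  rw [wickMonomial_eq_permProdSum p q (zero_add b)]
  simp [permProdSum, List.ofFn_const, Fintype.card_perm, ← Nat.cast_smul_eq_nsmul ℂ, smul_smul,
    inv_mul_cancel₀ hb]

section Heisenberg

variable {A : Type*} [Ring A] [Algebra ℂ A] {p q c : A}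

/-- `p S(a,b)` in Wick monomials, given the exchange relation one degree lower. -/
theorem mul_wickMonomial_of_exchange {a b : ℕ}
    (h : 0 < b → p * wickMonomial p q a b - q * wickMonomial p q (a + 1) (b - 1) =
      (((a : ℂ) + b + 1) / 2) • (c * wickMonomial p q a (b - 1))) :
    p * wickMonomial p q a b =
      wickMonomial p q (a + 1) b + ((b : ℂ) / 2) • (c * wickMonomial p q a (b - 1)) := by
  have hrec := add_smul_wickMonomial p q (a + 1) b
  have h0 : ((a : ℂ) + 1 + b) ≠ 0 := by norm_cast; omega
  have hb : (b : ℂ) • (p * wickMonomial p q a b - q * wickMonomial p q (a + 1) (b - 1)) =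
      (b : ℂ) • ((((a : ℂ) + b + 1) / 2) • (c * wickMonomial p q a (b - 1))) := by
    rcases Nat.eq_zero_or_pos b with rfl | hb
    · simp
    · rw [h hb]
  push_cast [Nat.add_sub_cancel] at hrec
  apply smul_right_injective A h0
  simp only [smul_add, hrec]
  linear_combination (norm := module) hb

theorem mul_wickMonomial_right_of_exchange {a b : ℕ}
    (h : 0 < a → p * wickMonomial p q (a - 1) (b + 1) - q * wickMonomial p q a b =
      (((a : ℂ) + b + 1) / 2) • (c * wickMonomial p q (a - 1) b)) :
    q * wickMonomial p q a b =
      wickMonomial p q a (b + 1) - ((a : ℂ) / 2) • (c * wickMonomial p q (a - 1) b) := by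
  have hrec := add_smul_wickMonomial p q a (b + 1)
  have h0 : ((a : ℂ) + (b + 1)) ≠ 0 := by norm_cast
  have ha : (a : ℂ) • (p * wickMonomial p q (a - 1) (b + 1) - q * wickMonomial p q a b) =
      (a : ℂ) • ((((a : ℂ) + b + 1) / 2) • (c * wickMonomial p q (a - 1) b)) := by
    rcases Nat.eq_zero_or_pos a with rfl | ha
    · simp
    · rw [h ha]
  push_cast [Nat.add_sub_cancel] at hrec
  apply smul_right_injective A h0
  simp only [smul_sub, hrec]
  linear_combination (norm := module) -ha

theorem mul_wickMonomial_exchange (hcp : Commute c p) (hcq : Commute c q)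
    (hpq : p * q - q * p = c) (a b : ℕ) :
    p * wickMonomial p q a (b + 1) - q * wickMonomial p q (a + 1) b =
      (((a : ℂ) + b + 2) / 2) • (c * wickMonomial p q a b) := by
  induction hn : a + b using Nat.strong_induction_on generalizing a b with
  | _ n ih =>
    have hP : p * wickMonomial p q a b =
        wickMonomial p q (a + 1) b + ((b : ℂ) / 2) • (c * wickMonomial p q a (b - 1)) := by
      refine mul_wickMonomial_of_exchange fun hb => ?_
      obtain ⟨b, rfl⟩ := Nat.exists_eq_add_one.mpr hb
      rw [Nat.add_sub_cancel, ih (a + b) (by omega) a b rfl]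
      push_cast
      ring_nf
    have hQ : q * wickMonomial p q a b =
        wickMonomial p q a (b + 1) - ((a : ℂ) / 2) • (c * wickMonomial p q (a - 1) b) := by
      refine mul_wickMonomial_right_of_exchange fun ha => ?_
      obtain ⟨a, rfl⟩ := Nat.exists_eq_add_one.mpr ha
      rw [Nat.add_sub_cancel, ih (a + b) (by omega) a b rfl]
      push_cast
      ring_nf
    have hrec := congrArg (c * ·) (add_smul_wickMonomial p q a b)
    simp only [mul_add, mul_smul_comm] at hrec
    have hcomm : p * (q * wickMonomial p q a b) - q * (p * wickMonomial p q a b) =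
        c * wickMonomial p q a b := by
      rw [← mul_assoc, ← mul_assoc, ← sub_mul, hpq]
    have hp (x : A) : p * (c * x) = c * (p * x) := (hcp.symm.left_comm x)
    have hq (x : A) : q * (c * x) = c * (q * x) := (hcq.symm.left_comm x)
    rw [← sub_eq_iff_eq_add] at hP
    rw [eq_sub_iff_add_eq] at hQ
    rw [← hP, ← hQ]
    simp only [mul_add, mul_sub, mul_smul_comm, hp, hq]
    linear_combination (norm := module) hcomm - (1 / 2 : ℂ) • hrec

theorem mul_wickMonomial (hcp : Commute c p) (hcq : Commute c q)
    (hpq : p * q - q * p = c) (a b : ℕ) :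
    p * wickMonomial p q a b =
      wickMonomial p q (a + 1) b + ((b : ℂ) / 2) • (c * wickMonomial p q a (b - 1)) := by
  refine mul_wickMonomial_of_exchange fun hb => ?_
  obtain ⟨b, rfl⟩ := Nat.exists_eq_add_one.mpr hb
  rw [Nat.add_sub_cancel, mul_wickMonomial_exchange hcp hcq hpq]
  push_cast
  ring_nf

end Heisenberg

theorem Nat.cast_descFactorial_succ_eq_sub_mul {R : Type*} [Ring R] (n k : ℕ) :
    (n.descFactorial (k + 1) : R) = ((n : R) - k) * n.descFactorial k := by
  rw [Nat.descFactorial_succ, Nat.cast_mul]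
  rcases le_or_gt k n with h | h
  · rw [Nat.cast_sub h]
  · simp [Nat.descFactorial_of_lt h]

/-- The coefficient of `ε ^ r * S(a - r, b - r)` in the Wick expansion of `p ^ a * q ^ b`. -/
noncomputable def wickCoeff (a b r : ℕ) : ℂ :=
  (Complex.I / 2) ^ r / (r.factorial : ℂ) * (a.descFactorial r : ℂ) * (b.descFactorial r : ℂ)

theorem wickCoeff_succ_left (a b r : ℕ) :
    wickCoeff (a + 1) b (r + 1) =
      wickCoeff a b (r + 1) + wickCoeff a b r * (((b : ℂ) - r) / 2 * Complex.I) := by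
  have hr : (r.factorial : ℂ) ≠ 0 := by exact_mod_cast r.factorial_ne_zero
  have hr' : (r : ℂ) + 1 ≠ 0 := by exact_mod_cast r.succ_ne_zero
  simp only [wickCoeff, Nat.succ_descFactorial_succ, Nat.cast_mul, Nat.factorial_succ,
    Nat.cast_descFactorial_succ_eq_sub_mul]
  push_cast
  field_simp
  ring

theorem pow_mul_pow_eq_sum_wickCoeff {A : Type*} [Ring A] [Algebra ℂ A] {p q ε : A}
    (hεp : Commute ε p) (hεq : Commute ε q) (hpq : p * q - q * p = Complex.I • ε) (a b : ℕ) :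
    p ^ a * q ^ b =
      ∑ r ∈ Finset.range (b + 1), wickCoeff a b r • (ε ^ r * wickMonomial p q (a - r) (b - r)) := by
  induction a with
  | zero =>
    rw [Finset.sum_range_succ', Finset.sum_eq_zero]
    · simp [wickCoeff, wickMonomial_zero_left]
    · intro r _
      simp [wickCoeff]
  | succ a ih =>
    have hterm (r : ℕ) (hr : r ≤ b) :
        p * (wickCoeff a b r • (ε ^ r * wickMonomial p q (a - r) (b - r))) =
          wickCoeff a b r • (ε ^ r * wickMonomial p q (a + 1 - r) (b - r)) +
          (wickCoeff a b r * (((b : ℂ) - r) / 2 * Complex.I)) •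
            (ε ^ (r + 1) * wickMonomial p q (a + 1 - (r + 1)) (b - (r + 1))) := by
      rcases lt_or_ge a r with h | h
      · simp [wickCoeff, Nat.descFactorial_of_lt h]
      · rw [mul_smul_comm, (hεp.pow_left r).symm.left_comm,
          mul_wickMonomial (hεp.smul_left Complex.I) (hεq.smul_left Complex.I) hpq,
          ← Nat.sub_add_comm h, Nat.cast_sub hr, Nat.add_sub_add_right, Nat.sub_sub, pow_succ]
        simp only [mul_add, smul_add, mul_smul_comm, smul_mul_assoc, smul_smul, mul_assoc]
    rw [pow_succ', mul_assoc, ih, Finset.mul_sum,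
      Finset.sum_congr rfl fun r hr => hterm r (Nat.lt_succ_iff.mp (Finset.mem_range.mp hr)),
      Finset.sum_add_distrib, Finset.sum_range_succ', Finset.sum_range_succ _ b,
      Finset.sum_range_succ' _ b]
    simp only [wickCoeff_succ_left, add_smul, Finset.sum_add_distrib]
    simp [wickCoeff]
    abel

/-- In the Heisenberg algebra with `[p,q] = iε`, the normal monomials expand in
Wick monomials:
`N(a,b) = p^a q^b = Σ_{r=0}^{min(a,b)} ((iε/2)^r/r!)·(a!/(a-r)!)·(b!/(b-r)!)·S(a-r,b-r)`. -/
theorem normal_eq_sum_wick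
    {A : Type*} [Ring A] [Algebra ℂ A] (p q ε : A)
    (hεp : ε * p = p * ε) (hεq : ε * q = q * ε)
    (hpq : p * q - q * p = Complex.I • ε)
    (a b : ℕ) :
    p ^ a * q ^ b =
      ∑ r ∈ Finset.range (min a b + 1),
        ((((Complex.I / 2) ^ r / (r.factorial : ℂ)) *
          (a.descFactorial r : ℂ) * (b.descFactorial r : ℂ)) •
          (ε ^ r * wickMonomial p q (a - r) (b - r))) := by
  rw [pow_mul_pow_eq_sum_wickCoeff hεp hεq hpq]
  refine (Finset.sum_subset (Finset.range_mono (by omega)) fun r hr hr' => ?_).symm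
  rw [Finset.mem_range] at hr hr'
  simp [wickCoeff, Nat.descFactorial_of_lt (show a < r by omega)]
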